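/- arXiv:math/0506175 — 3 statements merged into one kernel-verified Lean document; each statement's English description precedes it below -/
import Mathlib

section
/- Let (V, g) be a real inner product space of dimension 2n (n ≥ 1), let I be a linear endomorphism of V with I² = −id_V that is an isometry of g, and let ω be the alternating 2-form ω(v,w) = g(Iv,w), regarded as an element of ⋀²V*. Then for all v, w ∈ V*, the identity n·(ω^{n−1} ∧ v ∧ w) = ω(v♭, w♭)·ω^n holds in ⋀^{2n}V*, where ♭ : V* → V is the inverse of the isomorphism V → V*, x ↦ g(x,·). -/
/-- The element of `⋀² V*` (inside the exterior algebra of the dual space) corresponding to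
a bilinear form `B` on `V` (given as a linear map `V →ₗ V*`): in terms of a basis `(eᵢ)`
with dual basis `(eⁱ)`, it is `∑_{i<j} B(eᵢ,eⱼ) eⁱ ∧ eʲ = ½ ∑_{i,j} B(eᵢ,eⱼ) eⁱ ∧ eʲ`. -/
noncomputable def extOfForm {V : Type} [AddCommGroup V] [Module ℝ V] [FiniteDimensional ℝ V]
    (B : V →ₗ[ℝ] Module.Dual ℝ V) : ExteriorAlgebra ℝ (Module.Dual ℝ V) :=
  (2⁻¹ : ℝ) • TensorProduct.lift
    (((LinearMap.mul ℝ (ExteriorAlgebra ℝ (Module.Dual ℝ V))).compl₂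
        (ExteriorAlgebra.ι ℝ)) ∘ₗ (ExteriorAlgebra.ι ℝ))
    ((dualTensorHomEquiv ℝ V (Module.Dual ℝ V)).symm B)

open scoped TensorProduct

/-- Wedge map on `V* ⊗ V*`. -/
noncomputable def wedgeT (V : Type) [AddCommGroup V] [Module ℝ V] :
    Module.Dual ℝ V ⊗[ℝ] Module.Dual ℝ V →ₗ[ℝ] ExteriorAlgebra ℝ (Module.Dual ℝ V) :=
  TensorProduct.lift
    (((LinearMap.mul ℝ (ExteriorAlgebra ℝ (Module.Dual ℝ V))).compl₂
        (ExteriorAlgebra.ι ℝ)) ∘ₗ (ExteriorAlgebra.ι ℝ))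

theorem wedgeT_tmul {V : Type} [AddCommGroup V] [Module ℝ V] (a c : Module.Dual ℝ V) :
    wedgeT V (a ⊗ₜ c) = ExteriorAlgebra.ι ℝ a * ExteriorAlgebra.ι ℝ c := by
  simp [wedgeT]

/-- Interior product. -/
noncomputable def intr {V : Type} [AddCommGroup V] [Module ℝ V] (x : V) :
    ExteriorAlgebra ℝ (Module.Dual ℝ V) →ₗ[ℝ] ExteriorAlgebra ℝ (Module.Dual ℝ V) :=
  CliffordAlgebra.contractLeft (Q := (0 : QuadraticForm ℝ (Module.Dual ℝ V)))
    (Module.Dual.eval ℝ V x)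

theorem intr_ι_mul {V : Type} [AddCommGroup V] [Module ℝ V] (x : V) (a : Module.Dual ℝ V)
    (b : ExteriorAlgebra ℝ (Module.Dual ℝ V)) :
    intr x (ExteriorAlgebra.ι ℝ a * b) = a x • b - ExteriorAlgebra.ι ℝ a * intr x b :=
  CliffordAlgebra.contractLeft_ι_mul _ a b

theorem intr_ι {V : Type} [AddCommGroup V] [Module ℝ V] (x : V) (a : Module.Dual ℝ V) :
    intr x (ExteriorAlgebra.ι ℝ a) = algebraMap ℝ _ (a x) :=
  CliffordAlgebra.contractLeft_ι _ (Module.Dual.eval ℝ V x) a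

theorem intr_wedgeT_mul {V : Type} [AddCommGroup V] [Module ℝ V] (x : V)
    (t : Module.Dual ℝ V ⊗[ℝ] Module.Dual ℝ V)
    (b : ExteriorAlgebra ℝ (Module.Dual ℝ V)) :
    intr x (wedgeT V t * b) =
      ExteriorAlgebra.ι ℝ (dualTensorHom ℝ V _ t x) * b
      - ExteriorAlgebra.ι ℝ ((dualTensorHom ℝ V _ t).flip x) * b + wedgeT V t * intr x b := by
  induction t using TensorProduct.induction_on with
  | zero =>
    have : (LinearMap.flip (0 : V →ₗ[ℝ] Module.Dual ℝ V)) x = 0 := by ext; simp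
    simp [this]
  | add s t hs ht =>
    simp only [map_add, add_mul, hs, ht, LinearMap.add_apply]
    have : (dualTensorHom ℝ V (Module.Dual ℝ V) s + dualTensorHom ℝ V _ t).flip x
      = (dualTensorHom ℝ V (Module.Dual ℝ V) s).flip x + (dualTensorHom ℝ V _ t).flip x := by
      ext; simp
    rw [this, map_add, add_mul]
    abel
  | tmul a c =>
    have : (dualTensorHom ℝ V (Module.Dual ℝ V) (a ⊗ₜ c)).flip x = c x • a := by
      ext y; simp [dualTensorHom_apply, mul_comm]
    rw [this, wedgeT_tmul, dualTensorHom_apply, mul_assoc, intr_ι_mul, intr_ι_mul, mul_sub,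
      map_smul, map_smul, smul_mul_assoc, smul_mul_assoc, mul_smul_comm, mul_assoc]
    abel

theorem wedgeT_comm {V : Type} [AddCommGroup V] [Module ℝ V]
    (t : Module.Dual ℝ V ⊗[ℝ] Module.Dual ℝ V) (u : Module.Dual ℝ V) :
    Commute (wedgeT V t) (ExteriorAlgebra.ι ℝ u) := by
  have anti : ∀ a c : Module.Dual ℝ V, ExteriorAlgebra.ι ℝ a * ExteriorAlgebra.ι ℝ c
      = - (ExteriorAlgebra.ι ℝ c * ExteriorAlgebra.ι ℝ a) := fun a c =>
    eq_neg_of_add_eq_zero_left (ExteriorAlgebra.ι_add_mul_swap a c)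
  induction t using TensorProduct.induction_on with
  | zero => simp
  | add s t hs ht => rw [map_add]; exact hs.add_left ht
  | tmul a c =>
    rw [wedgeT_tmul, Commute, SemiconjBy, mul_assoc, anti c u, mul_neg, ← mul_assoc, anti a u,
      neg_mul, neg_neg, mul_assoc]

theorem wedgeT_mem {V : Type} [AddCommGroup V] [Module ℝ V]
    (t : Module.Dual ℝ V ⊗[ℝ] Module.Dual ℝ V) :
    wedgeT V t ∈ (LinearMap.range (ExteriorAlgebra.ι ℝ (M := Module.Dual ℝ V))) ^ 2 := by
  induction t using TensorProduct.induction_on with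
  | zero => simp
  | add s t hs ht => rw [map_add]; exact add_mem hs ht
  | tmul a c =>
    rw [wedgeT_tmul, pow_two]
    exact Submodule.mul_mem_mul ⟨a, rfl⟩ ⟨c, rfl⟩

theorem extOfForm_eq {V : Type} [AddCommGroup V] [Module ℝ V] [FiniteDimensional ℝ V]
    (B : V →ₗ[ℝ] Module.Dual ℝ V) :
    extOfForm B = wedgeT V ((2⁻¹ : ℝ) • (dualTensorHomEquiv ℝ V (Module.Dual ℝ V)).symm B) := by
  rw [map_smul]; rfl

theorem intr_ext_mul {V : Type} [AddCommGroup V] [Module ℝ V] [FiniteDimensional ℝ V]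
    (B : V →ₗ[ℝ] Module.Dual ℝ V) (hB : ∀ x y, B x y = - B y x) (x : V)
    (b : ExteriorAlgebra ℝ (Module.Dual ℝ V)) :
    intr x (extOfForm B * b) = ExteriorAlgebra.ι ℝ (B x) * b + extOfForm B * intr x b := by
  have h : dualTensorHom ℝ V (Module.Dual ℝ V)
      ((2⁻¹ : ℝ) • (dualTensorHomEquiv ℝ V (Module.Dual ℝ V)).symm B) = (2⁻¹ : ℝ) • B := by
    rw [map_smul]
    congr 1
    exact (dualTensorHomEquiv ℝ V (Module.Dual ℝ V)).apply_symm_apply B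
  rw [extOfForm_eq, intr_wedgeT_mul, h, ← sub_mul, ← map_sub]
  congr 3
  ext y
  have := hB x y
  simp only [LinearMap.sub_apply, LinearMap.smul_apply, LinearMap.flip_apply, smul_eq_mul]
  linarith

theorem intr_ext_pow_mul {V : Type} [AddCommGroup V] [Module ℝ V] [FiniteDimensional ℝ V]
    (B : V →ₗ[ℝ] Module.Dual ℝ V) (hB : ∀ x y, B x y = - B y x) (x : V) (m : ℕ)
    (b : ExteriorAlgebra ℝ (Module.Dual ℝ V)) :
    intr x (extOfForm B ^ (m + 1) * b) =
      ((m + 1 : ℕ) : ℝ) • (extOfForm B ^ m * ExteriorAlgebra.ι ℝ (B x) * b)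
        + extOfForm B ^ (m + 1) * intr x b := by
  induction m with
  | zero => simp [intr_ext_mul B hB]
  | succ m ih =>
    have hc : Commute (extOfForm B ^ (m + 1)) (ExteriorAlgebra.ι ℝ (B x)) := by
      rw [extOfForm_eq]; exact (wedgeT_comm _ _).pow_left _
    rw [pow_succ' _ (m + 1), mul_assoc, intr_ext_mul B hB, ih, mul_add, mul_smul_comm,
      ← mul_assoc, ← hc.eq, ← mul_assoc, ← mul_assoc, ← mul_assoc, ← pow_succ', ← add_assoc]
    congr 1
    push_cast
    module

theorem ext_pow_mul_zero {V : Type} [AddCommGroup V] [Module ℝ V] [FiniteDimensional ℝ V]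
    (n : ℕ) (hdim : Module.finrank ℝ V = 2 * n)
    (B : V →ₗ[ℝ] Module.Dual ℝ V) (w : Module.Dual ℝ V) :
    extOfForm B ^ n * ExteriorAlgebra.ι ℝ w = 0 := by
  have h : extOfForm B ^ n * ExteriorAlgebra.ι ℝ w ∈
      (⋀[ℝ]^(2 * n + 1) (Module.Dual ℝ V)) := by
    rw [ExteriorAlgebra.exteriorPower, pow_succ, pow_mul, extOfForm_eq]
    exact Submodule.mul_mem_mul (Submodule.pow_mem_pow _ (wedgeT_mem _) _) ⟨w, rfl⟩
  have hz : Module.finrank ℝ (⋀[ℝ]^(2 * n + 1) (Module.Dual ℝ V)) = 0 := by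
    rw [exteriorPower.finrank_eq, Subspace.dual_finrank_eq, hdim]
    exact Nat.choose_succ_self _
  rw [Submodule.finrank_eq_zero.mp hz] at h
  simpa using h



/-- Let `(V, g)` be a real inner product space of dimension `2n` (`n ≥ 1`), where the
inner product `g` is given as a (symmetric, positive definite, hence bijective) linear
map `V → V*`.  Let `I` be a linear endomorphism of `V` with `I² = -id` that is an
isometry of `g`, and let `ω` be the Kähler form `ω(v,w) = g(Iv,w)`, regarded as an
element of `⋀² V*`.  Then for all `v, w ∈ V*`:
`n • (ω^{n-1} ∧ v ∧ w) = ω(v♭, w♭) • ω^n` in the exterior algebra of `V*`, where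
`♭ : V* → V` is the inverse of `g : V → V*`. -/
theorem stmt_4 {V : Type} [AddCommGroup V] [Module ℝ V] [FiniteDimensional ℝ V]
    (n : ℕ) (hn : 1 ≤ n) (hdim : Module.finrank ℝ V = 2 * n)
    (g : V →ₗ[ℝ] Module.Dual ℝ V)
    (hgsymm : ∀ v w : V, g v w = g w v)
    (hgpos : ∀ v : V, v ≠ 0 → 0 < g v v)
    (hgbij : Function.Bijective g)
    (I : V →ₗ[ℝ] V) (hI2 : I ∘ₗ I = -LinearMap.id)
    (hIiso : ∀ v w : V, g (I v) (I w) = g v w) :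
    ∀ v w : Module.Dual ℝ V,
      (n : ℝ) • (extOfForm (g ∘ₗ I) ^ (n - 1) *
          ExteriorAlgebra.ι ℝ v * ExteriorAlgebra.ι ℝ w)
        = (g (I ((LinearEquiv.ofBijective g hgbij).symm v))
              ((LinearEquiv.ofBijective g hgbij).symm w))
            • extOfForm (g ∘ₗ I) ^ n := by
  intro v w
  have hII : ∀ x, I (I x) = -x := fun x => by
    simpa using LinearMap.congr_fun hI2 x
  have hB : ∀ x y, (g ∘ₗ I) x y = - (g ∘ₗ I) y x := by
    intro x y
    have h1 := hIiso (I x) y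
    rw [hII, map_neg, LinearMap.neg_apply, hgsymm x (I y)] at h1
    simp only [LinearMap.comp_apply]
    linarith
  set a := (LinearEquiv.ofBijective g hgbij).symm v with ha
  set c := (LinearEquiv.ofBijective g hgbij).symm w with hc
  have hga : g a = v := (LinearEquiv.ofBijective g hgbij).apply_symm_apply v
  have hgc : g c = w := (LinearEquiv.ofBijective g hgbij).apply_symm_apply w
  obtain ⟨m, rfl⟩ : ∃ m, n = m + 1 := ⟨n - 1, by omega⟩
  have key := intr_ext_pow_mul (g ∘ₗ I) hB (-(I a)) m (ExteriorAlgebra.ι ℝ w)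
  rw [ext_pow_mul_zero (m + 1) hdim, map_zero, intr_ι] at key
  have e1 : (g ∘ₗ I) (-(I a)) = v := by
    simp [hII, hga]
  have e2 : w (-(I a)) = - g (I a) c := by
    rw [map_neg, ← hgc, hgsymm]
  rw [e1, e2, map_neg, mul_neg, ← sub_eq_add_neg, ← Algebra.commutes, ← Algebra.smul_def] at key
  rw [Nat.add_sub_cancel]
  exact sub_eq_zero.mp key.symm
end

section
/- Let (V, g, I, J, K) be a hyper-Kähler vector space of real dimension 2n (n ≥ 1) with associated Kähler forms ω_I, ω_J, ω_K, let vol := (1/n!)·ω_I^n ∈ ⋀^{2n}V*, and for A ∈ {I, J, K} let ϖ_A be the bilinear form on V* determined by v ∧ ω_A^{n−1} ∧ w = ϖ_A(v,w)·vol, with induced linear map ϖ̂_A : V* → V**, v ↦ ϖ_A(v,·). Then each ϖ̂_A is bijective, and the relations ϖ̂_I⁻¹∘ϖ̂_J = −ϖ̂_J⁻¹∘ϖ̂_I, ϖ̂_J⁻¹∘ϖ̂_K = −ϖ̂_K⁻¹∘ϖ̂_J, and ϖ̂_K⁻¹∘ϖ̂_I = −ϖ̂_I⁻¹∘ϖ̂_K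 hold as endomorphisms of V*. -/
set_option synthInstance.maxHeartbeats 1000000
set_option maxHeartbeats 1000000

section helpers

open ExteriorAlgebra Module

variable {V : Type} [AddCommGroup V] [Module ℝ V] [FiniteDimensional ℝ V]

lemma ext_eq_sum {ι' : Type} [Fintype ι'] (b : Basis ι' ℝ V) (B : V →ₗ[ℝ] Dual ℝ V) :
    extOfForm B = (2⁻¹ : ℝ) • ∑ i, ι ℝ (b.coord i) * ι ℝ (B (b i)) := by
  classical
  have h : (dualTensorHomEquiv ℝ V (Dual ℝ V)).symm B
      = ∑ i, (b.coord i) ⊗ₜ[ℝ] (B (b i)) := by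
    rw [LinearEquiv.symm_apply_eq, map_sum]
    apply b.ext
    intro j
    simp [dualTensorHomEquiv, LinearMap.sum_apply, dualTensorHom_apply, Finsupp.single_apply]
  rw [extOfForm, h, map_sum]
  simp

lemma ext_smul (c : ℝ) (B : V →ₗ[ℝ] Dual ℝ V) : extOfForm (c • B) = c • extOfForm B := by
  simp only [extOfForm, map_smul]
  rw [smul_comm]

lemma map_ext (R : V ≃ₗ[ℝ] V) (B B' : V →ₗ[ℝ] Dual ℝ V)
    (h : ∀ v w, B' v w = B (R v) (R w)) :
    ExteriorAlgebra.map (R.toLinearMap.dualMap) (extOfForm B) = extOfForm B' := by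
  let b := finBasis ℝ V
  rw [ext_eq_sum b B, ext_eq_sum (b.map R.symm) B']
  simp only [map_smul, map_sum, map_mul, ExteriorAlgebra.map_apply_ι]
  congr 1
  refine Finset.sum_congr rfl fun i _ => ?_
  congr 2
  ext w
  simp [h]

lemma ι_anti (a b : Dual ℝ V) : ι ℝ a * ι ℝ b = - (ι ℝ b * ι ℝ a) :=
  eq_neg_of_add_eq_zero_left (ExteriorAlgebra.ι_add_mul_swap a b)

lemma ι_comm (B : V →ₗ[ℝ] Dual ℝ V) (v : Dual ℝ V) :
    ι ℝ v * extOfForm B = extOfForm B * ι ℝ v := by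
  rw [ext_eq_sum (finBasis ℝ V) B, mul_smul_comm, smul_mul_assoc, Finset.mul_sum, Finset.sum_mul]
  congr 1
  refine Finset.sum_congr rfl fun i _ => ?_
  rw [← mul_assoc, ι_anti v, neg_mul, mul_assoc, ι_anti v, mul_neg, neg_neg, mul_assoc]

lemma ι_comm_pow (B : V →ₗ[ℝ] Dual ℝ V) (v : Dual ℝ V) (k : ℕ) :
    ι ℝ v * extOfForm B ^ k = extOfForm B ^ k * ι ℝ v :=
  (show Commute _ _ from ι_comm B v).pow_right k

/-- contraction with a vector -/
noncomputable def ctr (x : V) :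
    ExteriorAlgebra ℝ (Dual ℝ V) →ₗ[ℝ] ExteriorAlgebra ℝ (Dual ℝ V) :=
  CliffordAlgebra.contractLeft (Q := (0 : QuadraticForm ℝ (Dual ℝ V))) (Dual.eval ℝ V x)

lemma ctr_ι_mul (x : V) (a : Dual ℝ V) (y : ExteriorAlgebra ℝ (Dual ℝ V)) :
    ctr x (ι ℝ a * y) = a x • y - ι ℝ a * ctr x y :=
  CliffordAlgebra.contractLeft_ι_mul (Q := (0 : QuadraticForm ℝ (Dual ℝ V))) _ a y

lemma ctr_one (x : V) : ctr x (1 : ExteriorAlgebra ℝ (Dual ℝ V)) = 0 :=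
  CliffordAlgebra.contractLeft_one (Q := (0 : QuadraticForm ℝ (Dual ℝ V))) _

lemma ctr_ext_mul (B : V →ₗ[ℝ] Dual ℝ V) (hB : ∀ v w, B v w = - B w v) (x : V)
    (y : ExteriorAlgebra ℝ (Dual ℝ V)) :
    ctr x (extOfForm B * y) = ι ℝ (B x) * y + extOfForm B * ctr x y := by
  let b := finBasis ℝ V
  have h1 : B x = ∑ i, b.coord i x • B (b i) := by
    conv_lhs => rw [← b.sum_repr x, map_sum]
    simp only [map_smul, Basis.coord_apply]
  have h2 : B x = ∑ i, (- B (b i) x) • b.coord i := by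
    apply b.ext
    intro j
    rw [hB x]
    simp [LinearMap.sum_apply, Finsupp.single_apply]
  have h3 : ι ℝ (B x) = (2⁻¹ : ℝ) • (∑ i, b.coord i x • ι ℝ (B (b i))
      + ∑ i, (- B (b i) x) • ι ℝ (b.coord i)) := by
    rw [← Finset.sum_congr rfl (fun i _ => map_smul (ι ℝ) (b.coord i x) (B (b i))),
      ← Finset.sum_congr rfl (fun i _ => map_smul (ι ℝ) (- B (b i) x) (b.coord i)),
      ← map_sum, ← map_sum, ← h1, ← h2, ← two_smul ℝ, smul_smul]
    norm_num
  rw [h3, ext_eq_sum b B]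
  simp only [smul_mul_assoc, map_smul, Finset.sum_mul, add_mul, map_sum, mul_assoc, ctr_ι_mul,
    ← smul_add, ← Finset.sum_add_distrib]
  congr 1
  refine Finset.sum_congr rfl fun i _ => ?_
  simp only [mul_sub, mul_smul_comm, neg_smul]
  abel

lemma ctr_pow_mul (B : V →ₗ[ℝ] Dual ℝ V) (hB : ∀ v w, B v w = - B w v) (x : V)
    (y : ExteriorAlgebra ℝ (Dual ℝ V)) (k : ℕ) :
    ctr x (extOfForm B ^ (k + 1) * y) =
      ((k : ℝ) + 1) • (extOfForm B ^ k * (ι ℝ (B x) * y)) + extOfForm B ^ (k + 1) * ctr x y := by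
  induction k with
  | zero => simp [ctr_ext_mul B hB]
  | succ k ih =>
    have h1 : ι ℝ (B x) * (extOfForm B ^ (k + 1) * y)
        = extOfForm B ^ (k + 1) * (ι ℝ (B x) * y) := by
      rw [← mul_assoc, ι_comm_pow, mul_assoc]
    have h2 : ∀ (j : ℕ) (z : ExteriorAlgebra ℝ (Dual ℝ V)),
        extOfForm B * (extOfForm B ^ j * z) = extOfForm B ^ (j + 1) * z := fun j z => by
      rw [← mul_assoc, ← pow_succ']
    rw [← h2 (k + 1) y, ctr_ext_mul B hB, ih, h1, mul_add, mul_smul_comm, h2, h2]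
    push_cast
    module

lemma sum_ι (B : V →ₗ[ℝ] Dual ℝ V) :
    ∑ i, ι ℝ ((finBasis ℝ V).coord i) * ι ℝ (B (finBasis ℝ V i)) = (2 : ℝ) • extOfForm B := by
  rw [ext_eq_sum (finBasis ℝ V) B, smul_smul]; norm_num

lemma pow_ne (B : V →ₗ[ℝ] Dual ℝ V) (hB : ∀ v w, B v w = - B w v)
    (hs : Function.Surjective B) (n : ℕ) (hdim : finrank ℝ V = 2 * n) (k : ℕ) (hk : k ≤ n) :
    extOfForm B ^ k ≠ 0 := by
  induction k with
  | zero => simp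
  | succ k ih =>
    intro h0
    apply ih (by omega)
    have h1 : ∀ w, extOfForm B ^ k * ι ℝ w = 0 := by
      intro w
      obtain ⟨x, rfl⟩ := hs w
      have := ctr_pow_mul B hB x 1 k
      rw [h0] at this
      simp only [zero_mul, map_zero, mul_one, add_zero] at this
      have hk : ((k : ℝ) + 1) ≠ 0 := by positivity
      exact (smul_eq_zero.mp this.symm).resolve_left hk
    have hc : ∀ (w : Dual ℝ V) (x : V), ctr x (ι ℝ w) = w x • 1 := by
      intro w x
      have := ctr_ι_mul x w 1
      simpa [ctr_one] using this
    cases k with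
    | zero =>
      have hp : 0 < finrank ℝ V := by omega
      exfalso
      let b := finBasis ℝ V
      have := hc (b.coord ⟨0, hp⟩) (b ⟨0, hp⟩)
      have h2 := h1 (b.coord ⟨0, hp⟩)
      simp only [pow_zero, one_mul] at h2
      rw [h2] at this
      simp at this
    | succ k =>
      have h2 : ∀ (w : Dual ℝ V) (x : V),
          w x • extOfForm B ^ (k+1) = ((k : ℝ) + 1) • (extOfForm B ^ k * (ι ℝ w * ι ℝ (B x))) := by
        intro w x
        have := ctr_pow_mul B hB x (ι ℝ w) k
        rw [h1, map_zero, hc, ι_anti, mul_neg, smul_neg, mul_smul_comm, mul_one] at this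
        rw [eq_comm, neg_add_eq_zero] at this
        exact this.symm
      have h3 := Finset.sum_congr (rfl : (Finset.univ : Finset (Fin (finrank ℝ V))) = _)
        (fun i _ => h2 ((finBasis ℝ V).coord i) (finBasis ℝ V i))
      rw [← Finset.smul_sum, ← Finset.mul_sum, sum_ι] at h3
      simp only [Basis.coord_apply, Basis.repr_self, Finsupp.single_eq_same, one_smul,
        Finset.sum_const, Finset.card_univ, Fintype.card_fin, mul_smul_comm, ← pow_succ,
        smul_smul] at h3
      rw [← Nat.cast_smul_eq_nsmul ℝ, ← sub_eq_zero, ← sub_smul] at h3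
      refine (smul_eq_zero.mp h3).resolve_left ?_
      rw [hdim]
      have : ((k : ℝ) + 1) + 1 ≤ n := by exact_mod_cast hk
      push_cast
      intro h
      linarith

lemma ext_mem (B : V →ₗ[ℝ] Dual ℝ V) : extOfForm B ∈ ⋀[ℝ]^2 (Dual ℝ V) := by
  rw [ext_eq_sum (finBasis ℝ V) B]
  refine Submodule.smul_mem _ _ (Submodule.sum_mem _ fun i _ => ?_)
  rw [exteriorPower, pow_two]
  exact Submodule.mul_mem_mul ⟨_, rfl⟩ ⟨_, rfl⟩

lemma top_zero (n : ℕ) (hdim : finrank ℝ V = n) (y : ExteriorAlgebra ℝ (Dual ℝ V))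
    (hy : y ∈ ⋀[ℝ]^(n+1) (Dual ℝ V)) : y = 0 := by
  rw [← ExteriorAlgebra.ιMulti_span_fixedDegree] at hy
  induction hy using Submodule.span_induction with
  | mem x h =>
    obtain ⟨v, rfl⟩ := h
    apply AlternatingMap.map_linearDependent
    intro hl
    have := hl.fintype_card_le_finrank
    rw [Subspace.dual_finrank_eq] at this
    simp at this
    omega
  | zero => rfl
  | add x y _ _ hx hy => rw [hx, hy, add_zero]
  | smul a x _ hx => rw [hx, smul_zero]

lemma ι_mul_pow_top (B : V →ₗ[ℝ] Dual ℝ V) (n : ℕ) (hdim : finrank ℝ V = 2 * n)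
    (v : Dual ℝ V) : extOfForm B ^ n * ι ℝ v = 0 := by
  apply top_zero _ hdim
  rw [exteriorPower, pow_succ, pow_mul]
  exact Submodule.mul_mem_mul (Submodule.pow_mem_pow _ (ext_mem B) n) ⟨_, rfl⟩

lemma key (B : V →ₗ[ℝ] Dual ℝ V) (hB : ∀ v w, B v w = - B w v) (m : ℕ)
    (hdim : finrank ℝ V = 2 * (m + 1)) (v : Dual ℝ V) (x : V) :
    ((m : ℝ) + 1) • (ι ℝ v * extOfForm B ^ m * ι ℝ (B x)) = v x • extOfForm B ^ (m + 1) := by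
  have h := ctr_pow_mul B hB x (ι ℝ v) m
  have hc : ctr x (ι ℝ v) = v x • 1 := by
    have := ctr_ι_mul x v 1
    simpa [ctr_one] using this
  rw [ι_mul_pow_top B _ hdim, map_zero, hc, ι_anti, mul_neg, smul_neg, mul_smul_comm, mul_one,
    eq_comm, neg_add_eq_zero] at h
  rw [← h, ι_comm_pow, mul_assoc]

/-- value of `ϖ_A` up to the ratio of volume elements -/
lemma varpi_val (m : ℕ) (hdim : finrank ℝ V = 2 * (m + 1))
    (A B : V →ₗ[ℝ] Dual ℝ V) (hA : ∀ v w, A v w = - A w v) (hB : ∀ v w, B v w = - B w v)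
    (hs : Function.Surjective A) (ϖ : Dual ℝ V →ₗ[ℝ] Dual ℝ V →ₗ[ℝ] ℝ)
    (h : ∀ v w, ι ℝ v * extOfForm B ^ m * ι ℝ w
      = ϖ v w • (((m + 1).factorial : ℝ)⁻¹ • extOfForm A ^ (m + 1))) :
    ∃ c : ℝ, extOfForm B ^ (m + 1) = c • extOfForm A ^ (m + 1) ∧
      ∀ v x, ϖ v (B x) = m.factorial * c * v x := by
  have hne := pow_ne A hA hs _ hdim (m + 1) le_rfl
  have h1 : ∀ (v : Dual ℝ V) (x : V), v x • extOfForm B ^ (m + 1)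
      = ((m.factorial : ℝ)⁻¹ * ϖ v (B x)) • extOfForm A ^ (m + 1) := by
    intro v x
    rw [← key B hB m hdim, h, smul_smul, smul_smul, Nat.factorial_succ]
    congr 1
    push_cast
    have : ((m : ℝ) + 1) ≠ 0 := by positivity
    field_simp
  have hp : 0 < finrank ℝ V := by omega
  let b := finBasis ℝ V
  have h2 := h1 (b.coord ⟨0, hp⟩) (b ⟨0, hp⟩)
  simp only [Basis.coord_apply, Basis.repr_self, Finsupp.single_eq_same, one_smul] at h2
  refine ⟨_, h2, fun v x => ?_⟩
  have h3 := h1 v x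
  rw [h2, smul_smul] at h3
  have h4 := smul_left_injective ℝ hne h3
  have : (m.factorial : ℝ) ≠ 0 := by positivity
  rw [mul_assoc, mul_comm _ (v x), h4]
  field_simp

/-- The top powers of two anticommuting Kähler forms agree up to sign. -/
lemma ratio_sq (m : ℕ) (hdim : finrank ℝ V = 2 * (m + 1)) (g : V →ₗ[ℝ] Dual ℝ V)
    (A B : V →ₗ[ℝ] V) (hA2 : ∀ v, A (A v) = - v) (hB2 : ∀ v, B (B v) = - v)
    (hAB : ∀ v, A (B v) = - B (A v))
    (hA : ∀ v w, g (A v) w = - g (A w) v) (hB : ∀ v w, g (B v) w = - g (B w) v)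
    (hgsymm : ∀ v w : V, g v w = g w v)
    (hs : Function.Surjective (g ∘ₗ A)) (c : ℝ)
    (h : extOfForm (g ∘ₗ B) ^ (m + 1) = c • extOfForm (g ∘ₗ A) ^ (m + 1)) : c ^ 2 = 1 := by
  have hne := pow_ne (g ∘ₗ A) hA hs _ hdim (m + 1) le_rfl
  have hR : ∀ v, (A + B) ((A + B) v) = (-2 : ℝ) • v := by
    intro v
    simp only [LinearMap.add_apply, map_add, hA2, hB2, hAB]
    module
  let R : V ≃ₗ[ℝ] V := LinearEquiv.ofLinearMap (A + B) ((-2⁻¹ : ℝ) • (A + B))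
    (by ext v; simp only [LinearMap.comp_apply, LinearMap.smul_apply, map_smul, hR, smul_smul]
        norm_num)
    (by ext v; simp only [LinearMap.comp_apply, LinearMap.smul_apply, hR, smul_smul]
        norm_num)
  have e : ∀ v, R v = A v + B v := fun v => rfl
  have hAA : ∀ v w, g (A v) (A w) = g v w := fun v w => by
    rw [hA, hA2, map_neg, LinearMap.neg_apply, neg_neg, hgsymm]
  have hBB : ∀ v w, g (B v) (B w) = g v w := fun v w => by
    rw [hB, hB2, map_neg, LinearMap.neg_apply, neg_neg, hgsymm]
  have hconjA : ∀ v, A (R v) = R (B v) := fun v => by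
    rw [e, e, map_add, hA2, hB2, add_comm]
  have hconjB : ∀ v, B (R v) = R (A v) := fun v => by
    rw [e, e, map_add, hA2, hB2, add_comm]
  have hRR : ∀ v w, g (R v) (R w) = 2 * g v w := fun v w => by
    have hx : g (A v) (B w) = - g (B v) (A w) := by
      rw [hA, hAB, map_neg, LinearMap.neg_apply, neg_neg, hB]
    simp only [e, map_add, LinearMap.add_apply, hAA, hBB, hx]
    ring
  have m1 := map_ext R (g ∘ₗ A) ((2 : ℝ) • (g ∘ₗ B)) (fun v w => by
    simp [hconjA, hRR])
  have m2 := map_ext R (g ∘ₗ B) ((2 : ℝ) • (g ∘ₗ A)) (fun v w => by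
    simp [hconjB, hRR])
  have h' := congrArg (ExteriorAlgebra.map R.toLinearMap.dualMap) h
  rw [map_smul, map_pow, map_pow, m1, m2, ext_smul, ext_smul, smul_pow, smul_pow, h,
    smul_comm, smul_smul c c] at h'
  have h2 : ((2 : ℝ) ^ (m+1)) ≠ 0 := by positivity
  have h3 := smul_right_injective _ h2 h'
  have h4 : (1 : ℝ) • extOfForm (g ∘ₗ A) ^ (m + 1) = (c * c) • extOfForm (g ∘ₗ A) ^ (m + 1) := by
    rw [one_smul]; exact h3
  have := smul_left_injective ℝ hne h4
  rw [pow_two, ← this]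

lemma varpi_bij (g : V →ₗ[ℝ] Dual ℝ V) (A : V →ₗ[ℝ] V)
    (ϖ : Dual ℝ V →ₗ[ℝ] Dual ℝ V →ₗ[ℝ] ℝ) (d : ℝ) (hd : d ≠ 0)
    (h : ∀ v x, ϖ v (g (A x)) = d * v x) : Function.Bijective ϖ := by
  have hi : Function.Injective ϖ := by
    rw [injective_iff_map_eq_zero]
    intro v hv
    ext x
    have := h v x
    rw [hv, LinearMap.zero_apply, eq_comm, mul_eq_zero] at this
    exact this.resolve_left hd
  refine ⟨hi, ?_⟩
  refine (LinearMap.injective_iff_surjective_of_finrank_eq_finrank ?_).mp hi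
  exact (Subspace.dual_finrank_eq (K := ℝ) (V := Dual ℝ V)).symm

lemma varpi_symm (g : V →ₗ[ℝ] Dual ℝ V) (A B : V →ₗ[ℝ] V)
    (hB2 : ∀ v, B (B v) = - v) (hs : Function.Surjective (g ∘ₗ A))
    (ϖA ϖB : Dual ℝ V →ₗ[ℝ] Dual ℝ V →ₗ[ℝ] ℝ) (a b : ℝ) (ha : a ≠ 0)
    (hA : ∀ v x, ϖA v (g (A x)) = a * v x) (hB : ∀ v x, ϖB v (g (B x)) = b * v x)
    (hbij : Function.Bijective ϖA) (v : Dual ℝ V) (x : V) :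
    (LinearEquiv.ofBijective ϖA hbij).symm (ϖB v) x = - (b / a) * v (B (A x)) := by
  have : (LinearEquiv.ofBijective ϖA hbij).symm (ϖB v) = (- (b / a)) • (v ∘ₗ B ∘ₗ A) := by
    rw [LinearEquiv.symm_apply_eq]
    apply LinearMap.ext
    intro w
    obtain ⟨x, rfl⟩ := hs w
    have h1 := hB v (-B (A x))
    rw [map_neg, hB2, neg_neg] at h1
    simp only [LinearEquiv.ofBijective_apply, LinearMap.comp_apply, hA, h1, LinearMap.smul_apply,
      map_neg, smul_eq_mul]
    field_simp
  rw [this]; simp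

lemma varpi_rel (g : V →ₗ[ℝ] Dual ℝ V) (A B : V →ₗ[ℝ] V)
    (hA2 : ∀ v, A (A v) = - v) (hB2 : ∀ v, B (B v) = - v)
    (hAB : ∀ v, A (B v) = - B (A v)) (hsA : Function.Surjective (g ∘ₗ A))
    (hsB : Function.Surjective (g ∘ₗ B))
    (ϖA ϖB : Dual ℝ V →ₗ[ℝ] Dual ℝ V →ₗ[ℝ] ℝ) (a b : ℝ) (ha : a ≠ 0) (hb : b ≠ 0)
    (hab : a ^ 2 = b ^ 2)
    (hA : ∀ v x, ϖA v (g (A x)) = a * v x) (hB : ∀ v x, ϖB v (g (B x)) = b * v x)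
    (hbA : Function.Bijective ϖA) (hbB : Function.Bijective ϖB) :
    ((LinearEquiv.ofBijective ϖA hbA).symm.toLinearMap ∘ₗ ϖB
          = -((LinearEquiv.ofBijective ϖB hbB).symm.toLinearMap ∘ₗ ϖA)) := by
  ext v x
  have h1 := varpi_symm g A B hB2 hsA ϖA ϖB a b ha hA hB hbA v x
  have h2 := varpi_symm g B A hA2 hsB ϖB ϖA b a hb hB hA hbB v x
  simp only [LinearMap.comp_apply, LinearMap.neg_apply, LinearEquiv.coe_coe]
  rw [h1, h2, hAB, map_neg]
  have : b / a = a / b := by field_simp; exact hab.symm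
  rw [this]; ring

end helpers

/-- Let `(V, g, I, J, K)` be a hyper-Kähler vector space of real dimension `2n` (`n ≥ 1`)
with Kähler forms `ω_I, ω_J, ω_K ∈ ⋀² V*`, let `vol := (1/n!) • ω_I^n`, and for
`A ∈ {I, J, K}` let `ϖ_A` be the bilinear form on `V*` determined by
`v ∧ ω_A^{n-1} ∧ w = ϖ_A(v,w) • vol`, with induced linear map `ϖ̂_A : V* → V**`.
Then each `ϖ̂_A` is bijective and `ϖ̂_I⁻¹∘ϖ̂_J = -ϖ̂_J⁻¹∘ϖ̂_I`,
`ϖ̂_J⁻¹∘ϖ̂_K = -ϖ̂_K⁻¹∘ϖ̂_J`, `ϖ̂_K⁻¹∘ϖ̂_I = -ϖ̂_I⁻¹∘ϖ̂_K` as endomorphisms of `V*`. -/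
theorem stmt_11 {V : Type} [AddCommGroup V] [Module ℝ V] [FiniteDimensional ℝ V]
    (n : ℕ) (hn : 1 ≤ n) (hdim : Module.finrank ℝ V = 2 * n)
    (g : V →ₗ[ℝ] Module.Dual ℝ V)
    (hgsymm : ∀ v w : V, g v w = g w v)
    (hgpos : ∀ v : V, v ≠ 0 → 0 < g v v)
    (hgbij : Function.Bijective g)
    (I J K : V →ₗ[ℝ] V)
    (hI2 : I ∘ₗ I = -LinearMap.id) (hJ2 : J ∘ₗ J = -LinearMap.id)
    (hK2 : K ∘ₗ K = -LinearMap.id) (hIJK : I ∘ₗ (J ∘ₗ K) = -LinearMap.id)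
    (hIiso : ∀ v w : V, g (I v) (I w) = g v w)
    (hJiso : ∀ v w : V, g (J v) (J w) = g v w)
    (hKiso : ∀ v w : V, g (K v) (K w) = g v w)
    (ϖI ϖJ ϖK : Module.Dual ℝ V →ₗ[ℝ] Module.Dual ℝ V →ₗ[ℝ] ℝ)
    (hϖI : ∀ v w : Module.Dual ℝ V,
      ExteriorAlgebra.ι ℝ v * extOfForm (g ∘ₗ I) ^ (n - 1) * ExteriorAlgebra.ι ℝ w
        = ϖI v w • ((n.factorial : ℝ)⁻¹ • extOfForm (g ∘ₗ I) ^ n))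
    (hϖJ : ∀ v w : Module.Dual ℝ V,
      ExteriorAlgebra.ι ℝ v * extOfForm (g ∘ₗ J) ^ (n - 1) * ExteriorAlgebra.ι ℝ w
        = ϖJ v w • ((n.factorial : ℝ)⁻¹ • extOfForm (g ∘ₗ I) ^ n))
    (hϖK : ∀ v w : Module.Dual ℝ V,
      ExteriorAlgebra.ι ℝ v * extOfForm (g ∘ₗ K) ^ (n - 1) * ExteriorAlgebra.ι ℝ w
        = ϖK v w • ((n.factorial : ℝ)⁻¹ • extOfForm (g ∘ₗ I) ^ n))
    :
    ∃ (hbI : Function.Bijective ϖI) (hbJ : Function.Bijective ϖJ)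
      (hbK : Function.Bijective ϖK),
      ((LinearEquiv.ofBijective ϖI hbI).symm.toLinearMap ∘ₗ ϖJ
          = -((LinearEquiv.ofBijective ϖJ hbJ).symm.toLinearMap ∘ₗ ϖI))
      ∧ ((LinearEquiv.ofBijective ϖJ hbJ).symm.toLinearMap ∘ₗ ϖK
          = -((LinearEquiv.ofBijective ϖK hbK).symm.toLinearMap ∘ₗ ϖJ))
      ∧ ((LinearEquiv.ofBijective ϖK hbK).symm.toLinearMap ∘ₗ ϖI
          = -((LinearEquiv.ofBijective ϖI hbI).symm.toLinearMap ∘ₗ ϖK)) := by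
  obtain ⟨m, rfl⟩ : ∃ m, n = m + 1 := ⟨n - 1, by omega⟩
  simp only [Nat.add_sub_cancel] at hϖI hϖJ hϖK
  have eI : ∀ v, I (I v) = -v := fun v => by simpa using LinearMap.congr_fun hI2 v
  have eJ : ∀ v, J (J v) = -v := fun v => by simpa using LinearMap.congr_fun hJ2 v
  have eK : ∀ v, K (K v) = -v := fun v => by simpa using LinearMap.congr_fun hK2 v
  have e0 : ∀ v, I (J (K v)) = -v := fun v => by simpa using LinearMap.congr_fun hIJK v
  have eIJ : ∀ v, K v = I (J v) := fun v => by
    have := e0 (K v)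
    rw [eK, map_neg, map_neg] at this
    exact (neg_injective this).symm
  have hJI : ∀ v, J (I v) = - I (J v) := fun v => by
    have h := eK (J v)
    rw [eIJ (J v), eIJ, eJ] at h
    simp only [map_neg] at h
    have h' := congrArg I (neg_injective h)
    rw [eI] at h'
    rw [← h', neg_neg]
  have hIJ' : ∀ v, I (J v) = - J (I v) := fun v => by rw [hJI, neg_neg]
  have hIK : ∀ v, I (K v) = - K (I v) := fun v => by
    rw [eIJ, eIJ, hJI, map_neg, neg_neg]
  have hKI : ∀ v, K (I v) = - I (K v) := fun v => by rw [hIK, neg_neg]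
  have hJK : ∀ v, J (K v) = - K (J v) := fun v => by
    rw [eIJ, eIJ, hJI]
  have anti : ∀ A : V →ₗ[ℝ] V, (∀ v, A (A v) = -v) → (∀ v w, g (A v) (A w) = g v w) →
      ∀ v w, g (A v) w = - g (A w) v := fun A h h' v w => by
    rw [← h' (A v) w, h, map_neg, LinearMap.neg_apply, hgsymm]
  have surj : ∀ A : V →ₗ[ℝ] V, (∀ v, A (A v) = -v) → Function.Surjective (g ∘ₗ A) :=
    fun A h => by
      rw [LinearMap.coe_comp]
      exact hgbij.2.comp fun v => ⟨-A v, by rw [map_neg, h, neg_neg]⟩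
  have aI := anti I eI hIiso
  have aJ := anti J eJ hJiso
  have aK := anti K eK hKiso
  have sI := surj I eI
  have sJ := surj J eJ
  have sK := surj K eK
  have hne := pow_ne (g ∘ₗ I) aI sI _ hdim (m + 1) le_rfl
  obtain ⟨cI, pI, vI⟩ := varpi_val m hdim (g ∘ₗ I) (g ∘ₗ I) aI aI sI ϖI hϖI
  obtain ⟨cJ, pJ, vJ⟩ := varpi_val m hdim (g ∘ₗ I) (g ∘ₗ J) aI aJ sI ϖJ hϖJ
  obtain ⟨cK, pK, vK⟩ := varpi_val m hdim (g ∘ₗ I) (g ∘ₗ K) aI aK sI ϖK hϖK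
  have qI : cI ^ 2 = 1 := by
    have h4 : (1 : ℝ) • extOfForm (g ∘ₗ I) ^ (m + 1) = cI • extOfForm (g ∘ₗ I) ^ (m + 1) := by
      rw [one_smul]; exact pI
    have := smul_left_injective ℝ hne h4
    rw [← this, one_pow]
  have qJ := ratio_sq m hdim g I J eI eJ hIJ' aI aJ hgsymm sI cJ pJ
  have qK := ratio_sq m hdim g I K eI eK hIK aI aK hgsymm sI cK pK
  have hf : (m.factorial : ℝ) ≠ 0 := by positivity
  have nz : ∀ c : ℝ, c ^ 2 = 1 → (m.factorial : ℝ) * c ≠ 0 := fun c hc => by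
    refine mul_ne_zero hf ?_
    rintro rfl
    norm_num at hc
  have sq : ∀ c d : ℝ, c ^ 2 = 1 → d ^ 2 = 1 →
      ((m.factorial : ℝ) * c) ^ 2 = ((m.factorial : ℝ) * d) ^ 2 := fun c d hc hd => by
    rw [mul_pow, mul_pow, hc, hd]
  have bI := varpi_bij g I ϖI _ (nz _ qI) vI
  have bJ := varpi_bij g J ϖJ _ (nz _ qJ) vJ
  have bK := varpi_bij g K ϖK _ (nz _ qK) vK
  exact ⟨bI, bJ, bK,
    varpi_rel g I J eI eJ hIJ' sI sJ ϖI ϖJ _ _ (nz _ qI) (nz _ qJ) (sq _ _ qI qJ) vI vJ bI bJ,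
    varpi_rel g J K eJ eK hJK sJ sK ϖJ ϖK _ _ (nz _ qJ) (nz _ qK) (sq _ _ qJ qK) vJ vK bJ bK,
    varpi_rel g K I eK eI hKI sK sI ϖK ϖI _ _ (nz _ qK) (nz _ qI) (sq _ _ qK qI) vK vI bK bI⟩
end

section
/- Let (V, g, I, J, K) be a hyper-Kähler vector space of real dimension 2n (n ≥ 1) with associated Kähler forms ω_I, ω_J, ω_K, let vol := (1/n!)·ω_I^n ∈ ⋀^{2n}V*, and for A ∈ {I, J, K} let ϖ_A be the bilinear form on V* determined by v ∧ ω_A^{n−1} ∧ w = ϖ_A(v,w)·vol, with induced linear map ϖ̂_A : V* → V**, v ↦ ϖ_A(v,·). Then the composition ϖ̂_I∘ϖ̂_J⁻¹∘ϖ̂_K : V* → V** is given by w ↦ (n−1)!·g*(·,w); equivalently, the bilinear form on V* corresponding to this composition equals (n−1)!·g*, where g* is the dual inner product on V*. In particular, this bilinear form is symmetric and positive definite. -/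
set_option synthInstance.maxHeartbeats 1000000
set_option maxHeartbeats 1000000

namespace HK
set_option linter.unusedSectionVars false
open scoped TensorProduct

variable {V : Type} [AddCommGroup V] [Module ℝ V] [FiniteDimensional ℝ V]

local notation "E" => ExteriorAlgebra ℝ (Module.Dual ℝ V)
local notation "ii" => ExteriorAlgebra.ι ℝ (M := Module.Dual ℝ V)

theorem ind {P : (V →ₗ[ℝ] Module.Dual ℝ V) → Prop} (h0 : P 0)
    (h1 : ∀ f m : Module.Dual ℝ V, P (dualTensorHom ℝ V (Module.Dual ℝ V) (f ⊗ₜ m)))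
    (h2 : ∀ A B, P A → P B → P (A + B)) (B) : P B := by
  obtain ⟨t, rfl⟩ := (dualTensorHomEquiv ℝ V (Module.Dual ℝ V)).surjective B
  induction t using TensorProduct.induction_on with
  | zero => simpa using h0
  | tmul f m => simpa using h1 f m
  | add a b ha hb => rw [map_add]; exact h2 _ _ ha hb

theorem ext_add (A B : V →ₗ[ℝ] Module.Dual ℝ V) :
    extOfForm (A + B) = extOfForm A + extOfForm B := by
  simp [extOfForm]

theorem ext_smul (c : ℝ) (B : V →ₗ[ℝ] Module.Dual ℝ V) :
    extOfForm (c • B) = c • extOfForm B := by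
  simp only [extOfForm, map_smul]
  rw [smul_comm]

theorem ext_zero : extOfForm (0 : V →ₗ[ℝ] Module.Dual ℝ V) = 0 := by
  simp [extOfForm]

theorem ext_rank1 (f m : Module.Dual ℝ V) :
    extOfForm (dualTensorHom ℝ V (Module.Dual ℝ V) (f ⊗ₜ m)) = (2⁻¹ : ℝ) • (ii f * ii m) := by
  have : (dualTensorHomEquiv ℝ V (Module.Dual ℝ V)).symm
      (dualTensorHom ℝ V (Module.Dual ℝ V) (f ⊗ₜ m)) = f ⊗ₜ m := by
    rw [LinearEquiv.symm_apply_eq]; simp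
  simp [extOfForm, this]

theorem ext_basis {ι : Type} [Fintype ι] [DecidableEq ι] (b : Module.Basis ι ℝ V)
    (B : V →ₗ[ℝ] Module.Dual ℝ V) :
    extOfForm B = (2⁻¹ : ℝ) • ∑ i, ii (b.coord i) * ii (B (b i)) := by
  have : (dualTensorHomEquiv ℝ V (Module.Dual ℝ V)).symm B = ∑ i, b.coord i ⊗ₜ B (b i) := by
    rw [LinearEquiv.symm_apply_eq]
    apply b.ext
    intro j
    simp [dualTensorHom_apply, LinearMap.sum_apply, Finsupp.single_apply]
  rw [extOfForm, this]
  simp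

theorem anti (f m : Module.Dual ℝ V) : ii f * ii m = - (ii m * ii f) := by
  rw [eq_neg_iff_add_eq_zero]
  exact ExteriorAlgebra.ι_add_mul_swap f m

theorem comm1 (B : V →ₗ[ℝ] Module.Dual ℝ V) (w : Module.Dual ℝ V) :
    Commute (extOfForm B) (ii w) := by
  induction B using ind with
  | h0 => simp [ext_zero]
  | h2 A B hA hB => rw [ext_add]; exact hA.add_left hB
  | h1 f m =>
    rw [ext_rank1]
    apply Commute.smul_left
    show _ * _ = _ * _
    rw [mul_assoc, anti m w, mul_neg, ← mul_assoc, anti f w]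
    simp [mul_assoc]

noncomputable def D (x : V) : E →ₗ[ℝ] E :=
  CliffordAlgebra.contractLeft (Q := (0 : QuadraticForm ℝ (Module.Dual ℝ V))) (Module.Dual.eval ℝ V x)

theorem D_mul (x : V) (f : Module.Dual ℝ V) (b : E) :
    D x (ii f * b) = f x • b - ii f * D x b :=
  CliffordAlgebra.contractLeft_ι_mul _ _ _

theorem D_i (x : V) (f : Module.Dual ℝ V) : D x (ii f) = algebraMap ℝ E (f x) :=
  CliffordAlgebra.contractLeft_ι _ _ _

theorem D_one (x : V) : D x (1 : E) = 0 :=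
  CliffordAlgebra.contractLeft_one _ _

theorem D_ext (x : V) (B : V →ₗ[ℝ] Module.Dual ℝ V) (b : E) :
    D x (extOfForm B * b) =
      (2⁻¹ : ℝ) • (ii (B x) - ii (B.flip x)) * b + extOfForm B * D x b := by
  induction B using ind with
  | h0 =>
    have : (0 : V →ₗ[ℝ] Module.Dual ℝ V).flip x = 0 := by ext; simp
    simp [ext_zero, this]
  | h2 A B hA hB =>
    rw [ext_add, add_mul, map_add, hA, hB]
    have : (A + B).flip x = A.flip x + B.flip x := by ext; simp
    rw [this, LinearMap.add_apply, map_add, map_add, add_mul]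
    simp only [smul_sub, smul_add, sub_mul, add_mul]
    abel
  | h1 f m =>
    have : (dualTensorHom ℝ V (Module.Dual ℝ V) (f ⊗ₜ m)).flip x = m x • f := by
      ext y; simp [mul_comm]
    rw [ext_rank1, this, dualTensorHom_apply]
    simp only [smul_mul_assoc, map_smul, mul_assoc, D_mul, mul_sub, smul_sub, smul_add, sub_mul,
      mul_smul_comm]
    abel

theorem D_skew (x : V) (B : V →ₗ[ℝ] Module.Dual ℝ V) (hB : ∀ x y, B x y = - B y x) (b : E) :
    D x (extOfForm B * b) = ii (B x) * b + extOfForm B * D x b := by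
  rw [D_ext]
  have : B.flip x = - B x := by ext y; simp [hB x y]
  rw [this, map_neg, sub_neg_eq_add, ← two_smul ℝ, smul_smul]
  norm_num

theorem D_pow (x : V) (B : V →ₗ[ℝ] Module.Dual ℝ V) (hB : ∀ x y, B x y = - B y x) (k : ℕ) :
    D x (extOfForm B ^ (k + 1)) = ((k + 1 : ℕ) : ℝ) • (extOfForm B ^ k * ii (B x)) := by
  induction k with
  | zero =>
    have := D_skew x B hB 1
    simpa [D_one] using this
  | succ k ih =>
    rw [pow_succ', D_skew x B hB, ih, mul_smul_comm, ← mul_assoc, ← pow_succ',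
      ((comm1 B (B x)).pow_left (k+1)).eq]
    push_cast
    module

theorem ext_mem (B : V →ₗ[ℝ] Module.Dual ℝ V) :
    extOfForm B ∈ ⋀[ℝ]^2 (Module.Dual ℝ V) := by
  induction B using ind with
  | h0 => simp [ext_zero]
  | h2 A B hA hB => rw [ext_add]; exact add_mem hA hB
  | h1 f m =>
    rw [ext_rank1]
    apply Submodule.smul_mem
    show _ ∈ (LinearMap.range ii) ^ 2
    rw [pow_two]
    exact Submodule.mul_mem_mul ⟨_, rfl⟩ ⟨_, rfl⟩

theorem top_zero (n : ℕ) (hdim : Module.finrank ℝ V = 2 * n) (B : V →ₗ[ℝ] Module.Dual ℝ V)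
    (v : Module.Dual ℝ V) : ii v * extOfForm B ^ n = 0 := by
  have h1 : ii v * extOfForm B ^ n ∈ ⋀[ℝ]^(2 * n + 1) (Module.Dual ℝ V) := by
    show _ ∈ (LinearMap.range ii) ^ (2 * n + 1)
    rw [pow_succ', pow_mul]
    exact Submodule.mul_mem_mul ⟨_, rfl⟩ (Submodule.pow_mem_pow _ (ext_mem B) n)
  have h2 : Module.finrank ℝ (⋀[ℝ]^(2 * n + 1) (Module.Dual ℝ V)) = 0 := by
    rw [exteriorPower.finrank_eq, Subspace.dual_finrank_eq, hdim, Nat.choose_succ_self]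
  rw [Submodule.finrank_eq_zero.mp h2] at h1
  simpa using h1

theorem key (n : ℕ) (hdim : Module.finrank ℝ V = 2 * (n + 1)) (B : V →ₗ[ℝ] Module.Dual ℝ V)
    (hB : ∀ x y, B x y = - B y x) (v : Module.Dual ℝ V) (x : V) :
    ((n + 1 : ℕ) : ℝ) • (ii v * extOfForm B ^ n * ii (B x)) = v x • extOfForm B ^ (n + 1) := by
  have h := congrArg (D x) (top_zero (n + 1) hdim B v)
  rw [D_mul, D_pow x B hB, map_zero, sub_eq_zero] at h
  rw [h, mul_smul_comm, mul_assoc]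

theorem pow_ne (n : ℕ) (hdim : Module.finrank ℝ V = 2 * n) (B : V →ₗ[ℝ] Module.Dual ℝ V)
    (hB : ∀ x y, B x y = - B y x) (hs : Function.Surjective B) (k : ℕ) (hk : k ≤ n) :
    extOfForm B ^ k ≠ 0 := by
  induction k with
  | zero => simp
  | succ k ih =>
    intro h0
    apply ih (by omega)
    have h1 : ∀ w, extOfForm B ^ k * ii w = 0 := by
      intro w
      obtain ⟨x, rfl⟩ := hs w
      have := D_pow x B hB k
      rw [h0, map_zero] at this
      have h3 : ((k + 1 : ℕ) : ℝ) ≠ 0 := by positivity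
      exact (smul_eq_zero.mp this.symm).resolve_left h3
    have h2 : ∀ w x, w x • extOfForm B ^ k = ii w * D x (extOfForm B ^ k) := by
      intro w x
      have h := h1 w
      rw [((comm1 B w).pow_left k).eq] at h
      have h' := congrArg (D x) h
      rwa [D_mul, map_zero, sub_eq_zero] at h'
    let b := Module.finBasis ℝ V
    have h3 : ∑ i, (b.coord i (b i)) • extOfForm B ^ k
        = ∑ i, ii (b.coord i) * D (b i) (extOfForm B ^ k) :=
      Finset.sum_congr rfl fun i _ => h2 _ _
    have h4 : ∑ i, (b.coord i (b i)) • extOfForm B ^ k = ((2 * n : ℕ) : ℝ) • extOfForm B ^ k := by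
      simp [← hdim, ← Nat.cast_smul_eq_nsmul ℝ]
    have h5 : ∑ i, ii (b.coord i) * D (b i) (extOfForm B ^ k)
        = ((2 * k : ℕ) : ℝ) • extOfForm B ^ k := by
      cases k with
      | zero => simp [D_one]
      | succ k =>
        have hb : ∑ i, ii (b.coord i) * ii (B (b i)) = (2 : ℝ) • extOfForm B := by
          rw [ext_basis b B, smul_smul]; norm_num
        simp_rw [D_pow _ B hB, ((comm1 B _).pow_left k).eq, mul_smul_comm, ← mul_assoc]
        rw [← Finset.smul_sum, ← Finset.sum_mul, hb, smul_mul_assoc, ← pow_succ', smul_smul]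
        push_cast
        congr 1
        ring
    rw [h4, h5, ← sub_eq_zero, ← sub_smul] at h3
    refine (smul_eq_zero.mp h3).resolve_left ?_
    have : ((2 * k : ℕ) : ℝ) < ((2 * n : ℕ) : ℝ) := by exact_mod_cast (by omega)
    linarith

theorem map_ext (U : V →ₗ[ℝ] V) (B : V →ₗ[ℝ] Module.Dual ℝ V) :
    ExteriorAlgebra.map U.dualMap (extOfForm B) = extOfForm (U.dualMap ∘ₗ B ∘ₗ U) := by
  induction B using ind with
  | h0 => simp [ext_zero]
  | h2 A B hA hB =>
    rw [ext_add, map_add, hA, hB, ← ext_add, LinearMap.add_comp, LinearMap.comp_add]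
  | h1 f m =>
    have : U.dualMap ∘ₗ (dualTensorHom ℝ V (Module.Dual ℝ V) (f ⊗ₜ m)) ∘ₗ U
        = dualTensorHom ℝ V (Module.Dual ℝ V) (U.dualMap f ⊗ₜ U.dualMap m) := by
      ext x y; simp
    rw [this, ext_rank1, ext_rank1]
    simp

/-- The bilinear form is determined up to the ratio of top powers. -/
theorem formula (n : ℕ) (hdim : Module.finrank ℝ V = 2 * (n + 1))
    (g : V →ₗ[ℝ] Module.Dual ℝ V) (hgsymm : ∀ v w : V, g v w = g w v)
    (hgpos : ∀ v : V, v ≠ 0 → 0 < g v v)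
    (A : V →ₗ[ℝ] V) (hA2 : ∀ x, A (A x) = - x) (hA : ∀ v w : V, g (A v) (w) = - g v (A w))
    (vol : E) (hvol : vol ≠ 0)
    (p : Module.Dual ℝ V →ₗ[ℝ] Module.Dual ℝ V →ₗ[ℝ] ℝ)
    (hp : ∀ v w : Module.Dual ℝ V,
      ii v * extOfForm (g ∘ₗ A) ^ n * ii w = p v w • (((n + 1).factorial : ℝ)⁻¹ • vol)) :
    ∃ c : ℝ, extOfForm (g ∘ₗ A) ^ (n + 1) = c • vol ∧
      ∀ x y, p (g x) (g y) = c * n.factorial * g (A x) y := by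
  have hB : ∀ x y, (g ∘ₗ A) x y = - (g ∘ₗ A) y x := by
    intro x y
    simp only [LinearMap.comp_apply]
    rw [hA, hgsymm]
  have hk := key n hdim (g ∘ₗ A) hB
  have hf : ((n + 1).factorial : ℝ) = (n + 1) * n.factorial := by
    push_cast [Nat.factorial_succ]; ring
  have hnf : (n.factorial : ℝ) ≠ 0 := by positivity
  have hn1 : (n + 1 : ℝ) ≠ 0 := by positivity
  obtain ⟨z, hz⟩ : ∃ z : V, z ≠ 0 := by
    have : Nontrivial V := Module.nontrivial_of_finrank_pos (R := ℝ) (by omega)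
    exact exists_ne 0
  have hc : ∃ c : ℝ, extOfForm (g ∘ₗ A) ^ (n + 1) = c • vol := by
    have h := hk (g z) z
    rw [hp] at h
    have hne : g z z ≠ 0 := (hgpos z hz).ne'
    refine ⟨(g z z)⁻¹ * (((n + 1 : ℕ) : ℝ) * (p (g z) ((g ∘ₗ A) z) * ((n + 1).factorial : ℝ)⁻¹)), ?_⟩
    rw [mul_smul, mul_smul, mul_smul, h, smul_smul, inv_mul_cancel₀ hne, one_smul]
  obtain ⟨c, hc⟩ := hc
  refine ⟨c, hc, fun x y => ?_⟩
  have h := hk (g x) (- A y)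
  rw [hp, hc] at h
  simp only [smul_smul] at h
  have h' := smul_left_injective ℝ hvol h
  simp only [LinearMap.comp_apply, map_neg, hA2, neg_neg] at h'
  rw [hA, hf] at *
  push_cast at h'
  field_simp at h'
  linarith

end HK

/-- Let `(V, g, I, J, K)` be a hyper-Kähler vector space of real dimension `2n` (`n ≥ 1`)
with Kähler forms `ω_I, ω_J, ω_K ∈ ⋀² V*`, let `vol := (1/n!) • ω_I^n`, and for
`A ∈ {I, J, K}` let `ϖ_A` be the bilinear form on `V*` determined by
`v ∧ ω_A^{n-1} ∧ w = ϖ_A(v,w) • vol`, with induced (bijective) linear map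
`ϖ̂_A : V* → V**`.  Then the bilinear form corresponding to the composition
`ϖ̂_I ∘ ϖ̂_J⁻¹ ∘ ϖ̂_K : V* → V**` equals `(n-1)! • g*`, where `g*` is the dual inner
product on `V*` (`g*(v,w) = g(v♭,w♭)` with `♭` the inverse of `g : V → V*`); in
particular this bilinear form is symmetric and positive definite. -/
theorem stmt_12 {V : Type} [AddCommGroup V] [Module ℝ V] [FiniteDimensional ℝ V]
    (n : ℕ) (hn : 1 ≤ n) (hdim : Module.finrank ℝ V = 2 * n)
    (g : V →ₗ[ℝ] Module.Dual ℝ V)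
    (hgsymm : ∀ v w : V, g v w = g w v)
    (hgpos : ∀ v : V, v ≠ 0 → 0 < g v v)
    (hgbij : Function.Bijective g)
    (I J K : V →ₗ[ℝ] V)
    (hI2 : I ∘ₗ I = -LinearMap.id) (hJ2 : J ∘ₗ J = -LinearMap.id)
    (hK2 : K ∘ₗ K = -LinearMap.id) (hIJK : I ∘ₗ (J ∘ₗ K) = -LinearMap.id)
    (hIiso : ∀ v w : V, g (I v) (I w) = g v w)
    (hJiso : ∀ v w : V, g (J v) (J w) = g v w)
    (hKiso : ∀ v w : V, g (K v) (K w) = g v w)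
    (ϖI ϖJ ϖK : Module.Dual ℝ V →ₗ[ℝ] Module.Dual ℝ V →ₗ[ℝ] ℝ)
    (hϖI : ∀ v w : Module.Dual ℝ V,
      ExteriorAlgebra.ι ℝ v * extOfForm (g ∘ₗ I) ^ (n - 1) * ExteriorAlgebra.ι ℝ w
        = ϖI v w • ((n.factorial : ℝ)⁻¹ • extOfForm (g ∘ₗ I) ^ n))
    (hϖJ : ∀ v w : Module.Dual ℝ V,
      ExteriorAlgebra.ι ℝ v * extOfForm (g ∘ₗ J) ^ (n - 1) * ExteriorAlgebra.ι ℝ w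
        = ϖJ v w • ((n.factorial : ℝ)⁻¹ • extOfForm (g ∘ₗ I) ^ n))
    (hϖK : ∀ v w : Module.Dual ℝ V,
      ExteriorAlgebra.ι ℝ v * extOfForm (g ∘ₗ K) ^ (n - 1) * ExteriorAlgebra.ι ℝ w
        = ϖK v w • ((n.factorial : ℝ)⁻¹ • extOfForm (g ∘ₗ I) ^ n))
    (hbI : Function.Bijective ϖI) (hbJ : Function.Bijective ϖJ)
    (hbK : Function.Bijective ϖK) :
    (∀ v w : Module.Dual ℝ V,
        ϖI ((LinearEquiv.ofBijective ϖJ hbJ).symm (ϖK v)) w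
          = ((n - 1).factorial : ℝ) *
              g ((LinearEquiv.ofBijective g hgbij).symm v)
                ((LinearEquiv.ofBijective g hgbij).symm w))
    ∧ (∀ v w : Module.Dual ℝ V,
        ϖI ((LinearEquiv.ofBijective ϖJ hbJ).symm (ϖK v)) w
          = ϖI ((LinearEquiv.ofBijective ϖJ hbJ).symm (ϖK w)) v)
    ∧ (∀ v : Module.Dual ℝ V, v ≠ 0 →
        0 < ϖI ((LinearEquiv.ofBijective ϖJ hbJ).symm (ϖK v)) v) := by
  obtain ⟨n, rfl⟩ : ∃ m, n = m + 1 := ⟨n - 1, by omega⟩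
  simp only [Nat.add_sub_cancel] at *
  have eI : ∀ x, I (I x) = -x := fun x => by simpa using LinearMap.congr_fun hI2 x
  have eJ : ∀ x, J (J x) = -x := fun x => by simpa using LinearMap.congr_fun hJ2 x
  have eK : ∀ x, K (K x) = -x := fun x => by simpa using LinearMap.congr_fun hK2 x
  have eIJK : ∀ x, I (J (K x)) = -x := fun x => by simpa using LinearMap.congr_fun hIJK x
  have eIJ : ∀ x, I (J x) = K x := fun x => by
    have := eIJK (K x)
    rw [eK, map_neg, map_neg] at this
    exact neg_injective this
  have eJK : ∀ x, J (K x) = I x := fun x => by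
    have := congrArg I (eIJK x)
    rw [eI, map_neg] at this
    exact neg_injective this
  have eIK : ∀ x, I (K x) = - J x := fun x => by rw [← eIJ, eI]
  have eJI : ∀ x, J (I x) = - K x := fun x => by rw [← eJK, eJ]
  have skew : ∀ A : V →ₗ[ℝ] V, (∀ x, A (A x) = -x) → (∀ v w, g (A v) (A w) = g v w) →
      ∀ v w, g (A v) w = - g v (A w) := by
    intro A h1 h2 v w
    rw [← h2 v (A w), h1]; simp
  have sI := skew I eI hIiso
  have sJ := skew J eJ hJiso
  have sK := skew K eK hKiso
  have alt : ∀ x y, (g ∘ₗ I) x y = - (g ∘ₗ I) y x := by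
    intro x y
    simp only [LinearMap.comp_apply]
    rw [sI, hgsymm]
  have surj : Function.Surjective (g ∘ₗ I) := by
    intro w
    obtain ⟨x, rfl⟩ := hgbij.2 w
    exact ⟨- I x, by simp [eI]⟩
  have hvol := HK.pow_ne (n + 1) hdim (g ∘ₗ I) alt surj (n + 1) le_rfl
  obtain ⟨cI, hcI, fI⟩ := HK.formula n hdim g hgsymm hgpos I eI sI _ hvol ϖI hϖI
  obtain ⟨cJ, hcJ, fJ⟩ := HK.formula n hdim g hgsymm hgpos J eJ sJ _ hvol ϖJ hϖJ
  obtain ⟨cK, hcK, fK⟩ := HK.formula n hdim g hgsymm hgpos K eK sK _ hvol ϖK hϖK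
  have hcI1 : cI = 1 := by
    apply smul_left_injective ℝ hvol
    simp only [one_smul]
    exact hcI.symm
  -- the rotation `1 - I`
  let U : V →ₗ[ℝ] V := LinearMap.id - I
  have UI : U.dualMap ∘ₗ (g ∘ₗ I) ∘ₗ U = (2 : ℝ) • (g ∘ₗ I) := by
    ext x y
    simp only [U, LinearMap.comp_apply, LinearMap.dualMap_apply, LinearMap.sub_apply,
      LinearMap.id_apply, map_sub, LinearMap.smul_apply, smul_eq_mul, eI, map_neg,
      LinearMap.neg_apply, hIiso]
    have := sI x y
    linarith
  have UJ : U.dualMap ∘ₗ (g ∘ₗ J) ∘ₗ U = (2 : ℝ) • (g ∘ₗ K) := by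
    ext x y
    have h1 := sI (J x) y
    have h2 := sI (K x) y
    rw [eIJ] at h1
    rw [eIK, map_neg, LinearMap.neg_apply] at h2
    simp only [U, LinearMap.comp_apply, LinearMap.dualMap_apply, LinearMap.sub_apply,
      LinearMap.id_apply, map_sub, LinearMap.smul_apply, smul_eq_mul, eJI, map_neg,
      LinearMap.neg_apply]
    linarith
  have hcJK : cK = cJ := by
    have h := congrArg (ExteriorAlgebra.map U.dualMap) hcJ
    rw [map_smul, map_pow, map_pow, HK.map_ext, HK.map_ext, UI, UJ, HK.ext_smul, HK.ext_smul,
      smul_pow, smul_pow, smul_comm cJ, hcK] at h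
    have h2 : (2 : ℝ) ^ (n + 1) ≠ 0 := by positivity
    exact smul_left_injective ℝ hvol (smul_right_injective _ h2 h)
  have hV : ∃ z : V, z ≠ 0 := by
    have : Nontrivial V := Module.nontrivial_of_finrank_pos (R := ℝ) (by omega)
    exact exists_ne 0
  have hcJ0 : cJ ≠ 0 := by
    intro h0
    obtain ⟨z, hz⟩ := hV
    have h1 : ϖJ (g z) = 0 := by
      ext w
      obtain ⟨y, rfl⟩ := hgbij.2 w
      rw [fJ, h0]; simp
    have h2 : g z = 0 := hbJ.1 (by rw [h1, map_zero])
    exact hz (hgbij.1 (by rw [h2, map_zero]))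
  have main : ∀ v w : Module.Dual ℝ V,
        ϖI ((LinearEquiv.ofBijective ϖJ hbJ).symm (ϖK v)) w
          = (n.factorial : ℝ) *
              g ((LinearEquiv.ofBijective g hgbij).symm v)
                ((LinearEquiv.ofBijective g hgbij).symm w) := by
    intro v w
    obtain ⟨x, rfl⟩ := hgbij.2 v
    obtain ⟨y, rfl⟩ := hgbij.2 w
    have hs : ∀ x, (LinearEquiv.ofBijective g hgbij).symm (g x) = x := fun x => by
      rw [LinearEquiv.symm_apply_eq]; rfl
    have ht : (LinearEquiv.ofBijective ϖJ hbJ).symm (ϖK (g x)) = g (- I x) := by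
      rw [LinearEquiv.symm_apply_eq]
      ext w
      obtain ⟨y, rfl⟩ := hgbij.2 w
      rw [LinearEquiv.ofBijective_apply, fK, fJ, map_neg, eJI, neg_neg, hcJK]
    rw [ht, hs, hs, fI, map_neg, eI, neg_neg, hcI1, one_mul]
  have pos : (0 : ℝ) < n.factorial := by positivity
  refine ⟨main, fun v w => by rw [main, main, hgsymm], fun v hv => ?_⟩
  rw [main]
  exact mul_pos pos (hgpos _ (by simpa using hv))
end
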